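/- arXiv:quant-ph/0608201 — 7 statements merged into one kernel-verified Lean document; each statement's English description precedes it below -/
import Mathlib

section
/- For every pure product state ρ = (|a⟩⟨a|) ⊗ (|b⟩⟨b|) on C^d ⊗ C^d (where a, b are unit vectors in C^d, d ≥ 2), the entropic entanglement parameter satisfies M(ρ) = 0. -/
open Matrix Kronecker BigOperators ComplexOrder

noncomputable section

namespace EEP

/-- `-(x * log₂ x)`; note `Real.logb 2 0 = 0`, giving the convention `0·log₂ 0 = 0`. -/
def negMulLog2 (x : ℝ) : ℝ := -(x * Real.logb 2 x)

/-- Shannon entropy (base 2) of a finite family of reals. -/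
def shannon {n : Type*} [Fintype n] (p : n → ℝ) : ℝ := ∑ i, negMulLog2 (p i)

/-- A quantum state: positive semidefinite (hence Hermitian) matrix with trace 1. -/
def IsState {n : Type*} [Fintype n] [DecidableEq n] (ρ : Matrix n n ℂ) : Prop :=
  ρ.PosSemidef ∧ ρ.trace = 1

/-- A rank-one orthogonal projection matrix. -/
def IsRankOneProj {n : Type*} [Fintype n] [DecidableEq n] (P : Matrix n n ℂ) : Prop :=
  P.IsHermitian ∧ P * P = P ∧ P.rank = 1

/-- A von Neumann measurement on `C^d ⊗ C^d`: a family of `d²` rank-one orthogonal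
projections, mutually orthogonal, summing to the identity. -/
def IsMeasurement {d : ℕ} (P : Fin (d^2) → Matrix (Fin d × Fin d) (Fin d × Fin d) ℂ) : Prop :=
  (∀ i, IsRankOneProj (P i)) ∧ (∀ i j, i ≠ j → P i * P j = 0) ∧ (∑ i, P i) = 1

/-- Klein entropy: Shannon entropy of the outcome distribution `pᵢ = Tr(ρ Pᵢ)`. -/
def kleinEntropy {d : ℕ} (ρ : Matrix (Fin d × Fin d) (Fin d × Fin d) ℂ)
    (P : Fin (d^2) → Matrix (Fin d × Fin d) (Fin d × Fin d) ℂ) : ℝ :=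
  shannon (fun i => (ρ * P i).trace.re)

/-- A product state: Kronecker product of two states on `C^d`. -/
def IsProductState {d : ℕ} (δ : Matrix (Fin d × Fin d) (Fin d × Fin d) ℂ) : Prop :=
  ∃ σA σB : Matrix (Fin d) (Fin d) ℂ, IsState σA ∧ IsState σB ∧ δ = σA ⊗ₖ σB

/-- Infimum of the Klein entropy over product states, for a fixed measurement. -/
def infProd {d : ℕ} (P : Fin (d^2) → Matrix (Fin d × Fin d) (Fin d × Fin d) ℂ) : ℝ :=
  sInf {x : ℝ | ∃ δ, IsProductState δ ∧ x = kleinEntropy δ P}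

/-- The entropic entanglement parameter
`M(ρ) = sup_P ( inf_{δ product} H(δ,P) − H(ρ,P) )`. -/
def eep {d : ℕ} (ρ : Matrix (Fin d × Fin d) (Fin d × Fin d) ℂ) : ℝ :=
  sSup {x : ℝ | ∃ P, IsMeasurement P ∧ x = infProd P - kleinEntropy ρ P}

/-- A separable state: finite convex combination of product states. -/
def IsSeparable {d : ℕ} (ρ : Matrix (Fin d × Fin d) (Fin d × Fin d) ℂ) : Prop :=
  ∃ (m : ℕ) (p : Fin m → ℝ) (δ : Fin m → Matrix (Fin d × Fin d) (Fin d × Fin d) ℂ),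
    (∀ i, 0 ≤ p i) ∧ (∑ i, p i) = 1 ∧ (∀ i, IsProductState (δ i)) ∧
    ρ = ∑ i, (p i : ℂ) • δ i

/-- Rank-one projection `|v⟩⟨v|` onto a vector `v`. -/
def projVec {n : Type*} (v : n → ℂ) : Matrix n n ℂ := Matrix.vecMulVec v (star v)

/-- Coefficient matrix `A` of a vector `ψ ∈ C^d ⊗ C^d`, `A i j = ψ (i,j)`. -/
def coeffMat {d : ℕ} (ψ : Fin d × Fin d → ℂ) : Matrix (Fin d) (Fin d) ℂ :=
  Matrix.of fun i j => ψ (i, j)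

/-- The squared Schmidt coefficients of `ψ`: the eigenvalues of `A Aᴴ`
where `A` is the coefficient matrix of `ψ`. -/
def schmidtSq {d : ℕ} (ψ : Fin d × Fin d → ℂ) : Fin d → ℝ :=
  (Matrix.isHermitian_mul_conjTranspose_self (coeffMat ψ)).eigenvalues

/-- Largest squared Schmidt coefficient (square of the largest singular value of `A`). -/
def maxSchmidtSq {d : ℕ} (ψ : Fin d × Fin d → ℂ) : ℝ := ⨆ i, schmidtSq ψ i

/-- A unit vector. -/
def IsUnitVec {n : Type*} [Fintype n] (ψ : n → ℂ) : Prop := (∑ p, Complex.normSq (ψ p)) = 1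

/-- A maximally entangled unit vector: all squared Schmidt coefficients equal `1/d`. -/
def IsMaxEntVec {d : ℕ} (ψ : Fin d × Fin d → ℂ) : Prop :=
  IsUnitVec ψ ∧ ∀ i, schmidtSq ψ i = 1 / d

/-- A von Neumann measurement in a maximally entangled basis. -/
def IsMaxEntMeasurement {d : ℕ}
    (P : Fin (d^2) → Matrix (Fin d × Fin d) (Fin d × Fin d) ℂ) : Prop :=
  IsMeasurement P ∧ ∀ i, ∃ ψ, IsMaxEntVec ψ ∧ P i = projVec ψ

/-- Von Neumann entropy: Shannon entropy of the eigenvalues. -/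
def vnEntropy {n : Type*} [Fintype n] [DecidableEq n] {ρ : Matrix n n ℂ}
    (h : ρ.IsHermitian) : ℝ := shannon h.eigenvalues

/-- Binary Shannon entropy. -/
def binEnt (x : ℝ) : ℝ := negMulLog2 x + negMulLog2 (1 - x)

theorem unit_dot {n : Type*} [Fintype n] {a : n → ℂ} (ha : IsUnitVec a) :
    a ⬝ᵥ star a = 1 := by
  unfold IsUnitVec at ha
  simp only [dotProduct, Pi.star_apply, RCLike.star_def, Complex.mul_conj]
  exact_mod_cast ha

theorem projVec_isState {n : Type*} [Fintype n] [DecidableEq n] {a : n → ℂ} (ha : IsUnitVec a) :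
    IsState (projVec a) := by
  refine ⟨posSemidef_vecMulVec_self_star a, ?_⟩
  rw [projVec, trace_vecMulVec, unit_dot ha]

theorem negMulLog2_nonneg {x : ℝ} (h0 : 0 ≤ x) (h1 : x ≤ 1) : 0 ≤ negMulLog2 x := by
  unfold negMulLog2
  have : Real.logb 2 x ≤ 0 := Real.logb_nonpos (by norm_num) h0 h1
  nlinarith

theorem prob_nonneg {n : Type*} [Fintype n] [DecidableEq n] {ρ P : Matrix n n ℂ}
    (h : ρ.PosSemidef) (hP : P.IsHermitian) (hPP : P * P = P) : 0 ≤ (ρ * P).trace.re := by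
  have h1 : (ρ * P).trace = (Pᴴ * ρ * P).trace := by
    rw [hP.eq, Matrix.trace_mul_cycle, hPP, Matrix.trace_mul_comm]
  rw [h1]
  exact (Complex.le_def.1 (h.conjTranspose_mul_mul_same P).trace_nonneg).1

theorem klein_nonneg {d : ℕ} {δ : Matrix (Fin d × Fin d) (Fin d × Fin d) ℂ}
    {P : Fin (d^2) → Matrix (Fin d × Fin d) (Fin d × Fin d) ℂ}
    (hδ : IsProductState δ) (hP : IsMeasurement P) : 0 ≤ kleinEntropy δ P := by
  obtain ⟨σA, σB, hA, hB, rfl⟩ := hδ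
  have hpsd : (σA ⊗ₖ σB).PosSemidef := hA.1.kronecker hB.1
  have h0 : ∀ i, 0 ≤ ((σA ⊗ₖ σB) * P i).trace.re := fun i =>
    prob_nonneg hpsd (hP.1 i).1 (hP.1 i).2.1
  have hs : ∑ i, ((σA ⊗ₖ σB) * P i).trace.re = 1 := by
    rw [← Complex.re_sum, ← Matrix.trace_sum, ← Matrix.mul_sum, hP.2.2, mul_one,
      Matrix.trace_kronecker, hA.2, hB.2]
    simp
  unfold kleinEntropy shannon
  refine Finset.sum_nonneg fun i _ => negMulLog2_nonneg (h0 i) ?_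
  rw [← hs]
  exact Finset.single_le_sum (f := fun i => ((σA ⊗ₖ σB) * P i).trace.re)
    (fun j _ => h0 j) (Finset.mem_univ i)

theorem infProd_le {d : ℕ} {δ : Matrix (Fin d × Fin d) (Fin d × Fin d) ℂ}
    {P : Fin (d^2) → Matrix (Fin d × Fin d) (Fin d × Fin d) ℂ}
    (hδ : IsProductState δ) (hP : IsMeasurement P) : infProd P ≤ kleinEntropy δ P := by
  refine csInf_le ⟨0, ?_⟩ ⟨δ, hδ, rfl⟩
  rintro x ⟨δ', h', rfl⟩
  exact klein_nonneg h' hP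

theorem infProd_nonneg {d : ℕ}
    {P : Fin (d^2) → Matrix (Fin d × Fin d) (Fin d × Fin d) ℂ}
    (hP : IsMeasurement P) : 0 ≤ infProd P := by
  refine Real.sInf_nonneg ?_
  rintro x ⟨δ', h', rfl⟩
  exact klein_nonneg h' hP

theorem kron_proj {d : ℕ} (a b : Fin d → ℂ) :
    projVec a ⊗ₖ projVec b = projVec (fun p : Fin d × Fin d => a p.1 * b p.2) := by
  ext ⟨i, j⟩ ⟨k, l⟩
  simp [projVec, vecMulVec_apply, kroneckerMap_apply]
  ring

theorem isUnit_kron {d : ℕ} {a b : Fin d → ℂ} (ha : IsUnitVec a) (hb : IsUnitVec b) :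
    IsUnitVec (fun p : Fin d × Fin d => a p.1 * b p.2) := by
  unfold IsUnitVec at *
  simp only [Complex.normSq_mul]
  rw [Fintype.sum_prod_type]
  dsimp only
  rw [← Finset.sum_mul_sum, ha, hb, one_mul]

theorem exists_meas {d : ℕ} (i0 : Fin (d^2)) (ψ : Fin d × Fin d → ℂ) (h : IsUnitVec ψ) :
    ∃ P : Fin (d^2) → Matrix (Fin d × Fin d) (Fin d × Fin d) ℂ,
      IsMeasurement P ∧ P i0 = projVec ψ := by
  have hn : ‖(WithLp.toLp 2 ψ : EuclideanSpace ℂ (Fin d × Fin d))‖ = 1 := by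
    rw [EuclideanSpace.norm_eq, Real.sqrt_eq_one]
    unfold IsUnitVec at h
    simpa [Complex.normSq_eq_norm_sq] using h
  obtain ⟨u, hu⟩ := Orthonormal.exists_orthonormalBasis_extension_of_card_eq (𝕜 := ℂ)
    (E := EuclideanSpace ℂ (Fin d × Fin d)) (ι := Fin (d^2))
    (by simp [sq]) (v := fun _ => WithLp.toLp 2 ψ) (s := {i0})
    (by
      constructor
      · intro i; simpa using hn
      · intro i j hij; exact absurd (Subsingleton.elim i j) hij)
  have ho : ∀ i j, star (u i : Fin d × Fin d → ℂ) ⬝ᵥ (u j : Fin d × Fin d → ℂ)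
      = if i = j then 1 else 0 := by
    intro i j
    have := orthonormal_iff_ite.1 u.orthonormal i j
    rw [EuclideanSpace.inner_eq_star_dotProduct, dotProduct_comm] at this
    exact this
  refine ⟨fun i => projVec (u i : Fin d × Fin d → ℂ), ⟨?_, ?_, ?_⟩, ?_⟩
  · intro i
    have hid : projVec (u i : Fin d × Fin d → ℂ) * projVec (u i : Fin d × Fin d → ℂ)
        = projVec (u i : Fin d × Fin d → ℂ) := by
      simp [projVec, vecMulVec_mul_vecMulVec, ho]
    refine ⟨(posSemidef_vecMulVec_self_star _).1, hid, ?_⟩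
    refine le_antisymm (rank_vecMulVec_le _ _) ?_
    rw [Nat.one_le_iff_ne_zero]
    intro h0
    rw [Matrix.rank, Submodule.finrank_eq_zero, LinearMap.range_eq_bot] at h0
    have h2 := LinearMap.congr_fun h0 (u i : Fin d × Fin d → ℂ)
    have h3 : (u i : Fin d × Fin d → ℂ) = 0 := by
      simpa [projVec, vecMulVec_mulVec, ho] using h2
    have h4 := ho i i
    rw [h3] at h4
    simp at h4
  · intro i j hij
    simp [projVec, vecMulVec_mul_vecMulVec, ho, hij]
  · let U : Matrix (Fin d × Fin d) (Fin (d^2)) ℂ := Matrix.of fun p i => u i p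
    have h1 : Uᴴ * U = 1 := by
      ext i j
      rw [Matrix.one_apply, ← ho i j]
      rfl
    have h2 : U * Uᴴ = 1 :=
      (Matrix.mul_eq_one_comm_of_card_eq _ _ _ (by simp [sq])).1 h1
    rw [← h2]
    ext p q
    rw [Matrix.sum_apply]
    rfl
  · show projVec (u i0 : Fin d × Fin d → ℂ) = projVec ψ
    rw [hu i0 rfl]

/-- For every pure product state ρ = |a⟩⟨a| ⊗ |b⟩⟨b| (a, b unit vectors, d ≥ 2), M(ρ) = 0. -/
theorem stmt1 {d : ℕ} (hd : 2 ≤ d) (a b : Fin d → ℂ)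
    (ha : IsUnitVec a) (hb : IsUnitVec b) :
    eep (projVec a ⊗ₖ projVec b) = 0 := by
  have hρ : IsProductState (projVec a ⊗ₖ projVec b) :=
    ⟨_, _, projVec_isState ha, projVec_isState hb, rfl⟩
  have hub : ∀ x ∈ {x : ℝ | ∃ P, IsMeasurement P ∧
      x = infProd P - kleinEntropy (projVec a ⊗ₖ projVec b) P}, x ≤ 0 := by
    rintro x ⟨P, hP, rfl⟩
    exact sub_nonpos.2 (infProd_le hρ hP)
  refine le_antisymm (Real.sSup_nonpos hub) ?_
  obtain ⟨P, hP, hP0⟩ := exists_meas (⟨0, by positivity⟩ : Fin (d^2)) _ (isUnit_kron ha hb)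
  rw [← kron_proj] at hP0
  have hk : kleinEntropy (projVec a ⊗ₖ projVec b) P = 0 := by
    unfold kleinEntropy shannon
    refine Finset.sum_eq_zero fun i _ => ?_
    rw [← hP0]
    beta_reduce
    by_cases hi : (⟨0, by positivity⟩ : Fin (d^2)) = i
    · subst hi
      rw [(hP.1 _).2.1, hP0, Matrix.trace_kronecker, (projVec_isState ha).2,
        (projVec_isState hb).2]
      simp [negMulLog2]
    · rw [hP.2.1 _ _ hi]
      simp [negMulLog2]
  refine le_csSup_of_le ⟨0, hub⟩ ⟨P, hP, rfl⟩ ?_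
  rw [hk, sub_zero]
  exact infProd_nonneg hP

end EEP
end
end

section
/- For every state ρ on C^d ⊗ C^d (d ≥ 2), the entropic entanglement parameter is bounded above by the information content of ρ: M(ρ) ≤ 2·log₂ d − S(ρ). -/
open Matrix Kronecker BigOperators ComplexOrder

noncomputable section

namespace EEP

lemma negMulLog2_eq (x : ℝ) : negMulLog2 x = (Real.log 2)⁻¹ * Real.negMulLog x := by
  unfold negMulLog2 Real.negMulLog Real.logb
  ring

lemma negMulLog2_concave : ConcaveOn ℝ (Set.Ici (0 : ℝ)) negMulLog2 := by
  have h : negMulLog2 = fun x => (Real.log 2)⁻¹ • Real.negMulLog x := by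
    funext x
    rw [negMulLog2_eq, smul_eq_mul]
  rw [h]
  exact Real.concaveOn_negMulLog.smul (inv_nonneg.2 (Real.log_nonneg (by norm_num)))

lemma shannon_nonneg {n : Type*} [Fintype n] (p : n → ℝ) (h0 : ∀ i, 0 ≤ p i)
    (h1 : ∑ i, p i = 1) : 0 ≤ shannon p := by
  refine Finset.sum_nonneg fun i _ => ?_
  rw [negMulLog2_eq]
  have hi : p i ≤ 1 := h1 ▸ Finset.single_le_sum (fun j _ => h0 j) (Finset.mem_univ i)
  exact mul_nonneg (inv_nonneg.2 (Real.log_nonneg (by norm_num)))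
    (Real.negMulLog_nonneg (h0 i) hi)

lemma shannon_le {n : Type*} [Fintype n] [Nonempty n] (p : n → ℝ) (h0 : ∀ i, 0 ≤ p i)
    (h1 : ∑ i, p i = 1) : shannon p ≤ Real.logb 2 (Fintype.card n) := by
  have hc : (0 : ℝ) < Fintype.card n := by exact_mod_cast Fintype.card_pos
  have h := negMulLog2_concave.le_map_sum (t := Finset.univ)
    (w := fun _ : n => (Fintype.card n : ℝ)⁻¹) (p := p)
    (fun _ _ => by positivity) (by simp [hc.ne']) (fun i _ => h0 i)
  simp only [smul_eq_mul, ← Finset.mul_sum, h1, mul_one] at h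
  have e : negMulLog2 (Fintype.card n : ℝ)⁻¹
      = (Fintype.card n : ℝ)⁻¹ * Real.logb 2 (Fintype.card n) := by
    rw [negMulLog2, Real.logb_inv]
    ring
  rw [e] at h
  exact le_of_mul_le_mul_left h (inv_pos.2 hc)

lemma state_eig {n : Type*} [Fintype n] [DecidableEq n] {ρ : Matrix n n ℂ} (hρ : IsState ρ) :
    (∀ i, 0 ≤ hρ.1.1.eigenvalues i) ∧ ∑ i, hρ.1.1.eigenvalues i = 1 := by
  refine ⟨fun i => hρ.1.eigenvalues_nonneg i, ?_⟩
  have h := hρ.1.1.trace_eq_sum_eigenvalues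
  replace h := hρ.2.symm.trans h
  have h2 := congrArg Complex.re h
  simpa using h2.symm

lemma trace_proj {n : Type*} [Fintype n] [DecidableEq n] {P : Matrix n n ℂ}
    (h : IsRankOneProj P) : P.trace = 1 := by
  have hi : IsIdempotentElem (Matrix.toLin' P) := by
    unfold IsIdempotentElem
    rw [Module.End.mul_eq_comp, ← Matrix.toLin'_mul, h.2.1]
  have ht := (LinearMap.IsIdempotentElem.isProj_range _ hi).trace
  rw [Matrix.trace_toLin'_eq] at ht
  rw [ht]
  have hr := h.2.2
  rw [Matrix.rank, ← Matrix.toLin'_apply'] at hr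
  rw [hr]
  simp

lemma exists_ds {d : ℕ} {ρ : Matrix (Fin d × Fin d) (Fin d × Fin d) ℂ} (h : ρ.IsHermitian)
    {P : Fin (d^2) → Matrix (Fin d × Fin d) (Fin d × Fin d) ℂ} (hP : IsMeasurement P) :
    ∃ D : Fin (d^2) → Fin d × Fin d → ℝ, (∀ i j, 0 ≤ D i j) ∧ (∀ i, ∑ j, D i j = 1) ∧
      (∀ j, ∑ i, D i j = 1) ∧ ∀ i, (ρ * P i).trace.re = ∑ j, D i j * h.eigenvalues j := by
  obtain ⟨h1, -, h3⟩ := hP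
  let U : Matrix (Fin d × Fin d) (Fin d × Fin d) ℂ := h.eigenvectorUnitary.1
  have hUU : U * Uᴴ = 1 := Unitary.coe_mul_star_self h.eigenvectorUnitary
  have hUU' : Uᴴ * U = 1 := Unitary.coe_star_mul_self h.eigenvectorUnitary
  refine ⟨fun i j => ((Uᴴ * P i * U) j j).re, fun i j => ?_, fun i => ?_, fun j => ?_,
    fun i => ?_⟩
  · have hp : (P i).PosSemidef := by
      have := Matrix.posSemidef_conjTranspose_mul_self (P i)
      rwa [(h1 i).1.eq, (h1 i).2.1] at this
    have := (hp.conjTranspose_mul_mul_same U).diag_nonneg (i := j)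
    exact (Complex.le_def.1 this).1
  · rw [← Complex.re_sum]
    change (Matrix.trace (Uᴴ * P i * U)).re = 1
    rw [Matrix.trace_mul_comm, ← mul_assoc, hUU, one_mul, trace_proj (h1 i)]
    simp
  · rw [← Complex.re_sum, ← Matrix.sum_apply, ← Finset.sum_mul, ← Finset.mul_sum, h3, mul_one, hUU']
    simp
  · have hs := h.spectral_theorem
    rw [Unitary.conjStarAlgAut_apply] at hs
    have e : (ρ * P i).trace
        = (Matrix.diagonal (RCLike.ofReal ∘ h.eigenvalues) * (Uᴴ * P i * U)).trace := by
      conv_lhs => rw [hs]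
      change (U * _ * Uᴴ * P i).trace = _
      rw [mul_assoc, mul_assoc, Matrix.trace_mul_comm, mul_assoc]
    rw [e, Matrix.trace, Complex.re_sum]
    refine Finset.sum_congr rfl fun j _ => ?_
    simp [Matrix.diag_apply, Matrix.diagonal_mul, mul_comm]

lemma prob {d : ℕ} {ρ : Matrix (Fin d × Fin d) (Fin d × Fin d) ℂ} (h : IsState ρ)
    {P : Fin (d^2) → Matrix (Fin d × Fin d) (Fin d × Fin d) ℂ} (hP : IsMeasurement P) :
    (∀ i, 0 ≤ (ρ * P i).trace.re) ∧ ∑ i, (ρ * P i).trace.re = 1 := by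
  obtain ⟨D, h0, -, h2, h3⟩ := exists_ds h.1.1 hP
  obtain ⟨e0, e1⟩ := state_eig h
  refine ⟨fun i => ?_, ?_⟩
  · rw [h3]
    exact Finset.sum_nonneg fun j _ => mul_nonneg (h0 i j) (e0 j)
  · simp_rw [h3]
    rw [Finset.sum_comm]
    simp_rw [← Finset.sum_mul, h2, one_mul, e1]

lemma vn_le {d : ℕ} {ρ : Matrix (Fin d × Fin d) (Fin d × Fin d) ℂ} (h : IsState ρ)
    {P : Fin (d^2) → Matrix (Fin d × Fin d) (Fin d × Fin d) ℂ} (hP : IsMeasurement P) :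
    vnEntropy h.1.1 ≤ kleinEntropy ρ P := by
  obtain ⟨D, h0, h1, h2, h3⟩ := exists_ds h.1.1 hP
  obtain ⟨e0, e1⟩ := state_eig h
  unfold vnEntropy kleinEntropy shannon
  calc ∑ j, negMulLog2 (h.1.1.eigenvalues j)
      = ∑ i, ∑ j, D i j * negMulLog2 (h.1.1.eigenvalues j) := by
        rw [Finset.sum_comm]
        simp_rw [← Finset.sum_mul, h2, one_mul]
    _ ≤ _ := by
        refine Finset.sum_le_sum fun i _ => ?_
        beta_reduce
        rw [h3]
        exact negMulLog2_concave.le_map_sum (fun j _ => h0 i j) (h1 i) (fun j _ => e0 j)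

lemma prod_state {d : ℕ} {δ : Matrix (Fin d × Fin d) (Fin d × Fin d) ℂ}
    (h : IsProductState δ) : IsState δ := by
  obtain ⟨a, b, ha, hb, rfl⟩ := h
  refine ⟨ha.1.kronecker hb.1, ?_⟩
  rw [Matrix.trace_kronecker, ha.2, hb.2, mul_one]

lemma mixed_state {d : ℕ} (hd : 2 ≤ d) : IsState ((d : ℂ)⁻¹ • (1 : Matrix (Fin d) (Fin d) ℂ)) := by
  have hc : (d : ℂ) ≠ 0 := by
    have : d ≠ 0 := by omega
    exact_mod_cast this
  refine ⟨Matrix.PosSemidef.one.smul ?_, ?_⟩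
  · have : (0 : ℂ) ≤ (d : ℂ) := by exact_mod_cast Nat.zero_le d
    exact inv_nonneg.2 this
  · simp [Matrix.trace_smul, hc]

/-- For every state ρ on C^d ⊗ C^d (d ≥ 2), M(ρ) ≤ 2 log₂ d − S(ρ). -/
theorem stmt2 {d : ℕ} (hd : 2 ≤ d) (ρ : Matrix (Fin d × Fin d) (Fin d × Fin d) ℂ)
    (hρ : IsState ρ) :
    eep ρ ≤ 2 * Real.logb 2 d - vnEntropy hρ.1.1 := by
  have hne : Nonempty (Fin d) := ⟨⟨0, by omega⟩⟩
  have hne2 : Nonempty (Fin (d ^ 2)) := ⟨⟨0, by positivity⟩⟩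
  have hlog : Real.logb 2 ((d ^ 2 : ℕ) : ℝ) = 2 * Real.logb 2 d := by
    push_cast
    rw [Real.logb_pow]
    norm_num
  refine Real.sSup_le ?_ ?_
  · rintro x ⟨P, hP, rfl⟩
    have h1 : infProd P ≤ 2 * Real.logb 2 d := by
      have hps : IsProductState (((d : ℂ)⁻¹ • (1 : Matrix (Fin d) (Fin d) ℂ)) ⊗ₖ
          ((d : ℂ)⁻¹ • (1 : Matrix (Fin d) (Fin d) ℂ))) :=
        ⟨_, _, mixed_state hd, mixed_state hd, rfl⟩
      have hm : kleinEntropy _ P ∈ {x : ℝ | ∃ δ, IsProductState δ ∧ x = kleinEntropy δ P} :=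
        ⟨_, hps, rfl⟩
      refine (csInf_le ⟨0, ?_⟩ hm).trans ?_
      · rintro y ⟨δ, hδ, rfl⟩
        obtain ⟨a, b⟩ := prob (prod_state hδ) hP
        exact shannon_nonneg _ a b
      · obtain ⟨a, b⟩ := prob (prod_state hps) hP
        have := shannon_le _ a b
        rw [Fintype.card_fin, hlog] at this
        exact this
    have h2 := vn_le hρ hP
    linarith
  · obtain ⟨a, b⟩ := state_eig hρ
    have := shannon_le _ a b
    rw [Fintype.card_prod, Fintype.card_fin, ← sq, hlog] at this
    unfold vnEntropy
    linarith

end EEP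
end
end

section
/- Every 2-dimensional subspace of C² ⊗ C² contains a nonzero product vector: if ψ₁, ψ₂ ∈ C² ⊗ C² are linearly independent, then there exist scalars α, β ∈ C, not both zero, and vectors u, v ∈ C² such that α·ψ₁ + β·ψ₂ = u ⊗ v. -/
open Matrix Kronecker BigOperators ComplexOrder

noncomputable section

namespace EEP

theorem prod_of_det (w : Fin 2 × Fin 2 → ℂ) (hw : w (0,0) * w (1,1) = w (0,1) * w (1,0)) :
    ∃ u v : Fin 2 → ℂ, w = fun p => u p.1 * v p.2 := by
  by_cases h0 : w (0,0) = 0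
  · by_cases h1 : w (0,1) = 0
    · refine ⟨![0, 1], ![w (1,0), w (1,1)], ?_⟩
      ext ⟨i, j⟩
      fin_cases i <;> fin_cases j <;> simp [h0, h1]
    · have h2 : w (1,0) = 0 := by
        rw [h0, zero_mul] at hw
        exact (mul_eq_zero.mp hw.symm).resolve_left h1
      refine ⟨![1, w (1,1) / w (0,1)], ![w (0,0), w (0,1)], ?_⟩
      ext ⟨i, j⟩
      fin_cases i <;> fin_cases j <;> simp [h0, h1, h2]
  · refine ⟨![1, w (1,0) / w (0,0)], ![w (0,0), w (0,1)], ?_⟩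
    ext ⟨i, j⟩
    fin_cases i <;> fin_cases j <;> simp [h0]
    field_simp
    linear_combination hw

/-- Every 2-dimensional subspace of C² ⊗ C² contains a nonzero product vector. -/
theorem stmt5 (ψ₁ ψ₂ : Fin 2 × Fin 2 → ℂ) (h : LinearIndependent ℂ ![ψ₁, ψ₂]) :
    ∃ α β : ℂ, ¬(α = 0 ∧ β = 0) ∧ ∃ u v : Fin 2 → ℂ,
      α • ψ₁ + β • ψ₂ = fun p => u p.1 * v p.2 := by
  by_cases ha : ψ₁ (0,0) * ψ₁ (1,1) - ψ₁ (0,1) * ψ₁ (1,0) = 0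
  · refine ⟨1, 0, by simp, prod_of_det _ ?_⟩
    simp only [Pi.add_apply, Pi.smul_apply, smul_eq_mul]
    linear_combination ha
  · obtain ⟨s, hs⟩ := IsAlgClosed.exists_eq_mul_self (discrim
      (ψ₁ (0,0) * ψ₁ (1,1) - ψ₁ (0,1) * ψ₁ (1,0))
      (ψ₁ (0,0) * ψ₂ (1,1) + ψ₂ (0,0) * ψ₁ (1,1) - ψ₁ (0,1) * ψ₂ (1,0) - ψ₂ (0,1) * ψ₁ (1,0))
      (ψ₂ (0,0) * ψ₂ (1,1) - ψ₂ (0,1) * ψ₂ (1,0)))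
    obtain ⟨x, hx⟩ := exists_quadratic_eq_zero ha ⟨s, hs⟩
    refine ⟨x, 1, by simp, prod_of_det _ ?_⟩
    simp only [Pi.add_apply, Pi.smul_apply, smul_eq_mul]
    linear_combination hx

end EEP
end
end

section
/- If P = (P_i) is a von Neumann measurement on C^d ⊗ C^d in a maximally entangled basis (each P_i is the projection onto a maximally entangled unit vector), then for every product state σ on C^d ⊗ C^d the Klein entropy satisfies H(σ, P) ≥ log₂ d. -/
open Matrix Kronecker BigOperators ComplexOrder

noncomputable section

namespace EEP

def fro {n : Type*} [Fintype n] (A : Matrix n n ℂ) : ℝ := ∑ i, ∑ j, ‖A i j‖ ^ 2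

lemma fro_nonneg {n : Type*} [Fintype n] (A : Matrix n n ℂ) : 0 ≤ fro A := by
  unfold fro; positivity

open scoped Matrix.Norms.Frobenius in
lemma fro_eq {n : Type*} [Fintype n] (A : Matrix n n ℂ) : fro A = ‖A‖ ^ 2 := by
  rw [Matrix.frobenius_norm_def, ← Real.sqrt_eq_rpow, Real.sq_sqrt]
  · simp [fro]
  · positivity

open scoped Matrix.Norms.Frobenius in
lemma fro_mul {n : Type*} [Fintype n] (A B : Matrix n n ℂ) :
    fro (A * B) ≤ fro A * fro B := by
  rw [fro_eq, fro_eq, fro_eq, ← mul_pow]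
  exact pow_le_pow_left₀ (norm_nonneg _) (Matrix.frobenius_norm_mul A B) 2

lemma trace_fro {n : Type*} [Fintype n] (A : Matrix n n ℂ) : (Aᴴ * A).trace = (fro A : ℂ) := by
  simp only [Matrix.trace, Matrix.diag, Matrix.mul_apply, Matrix.conjTranspose_apply, fro]
  rw [Finset.sum_comm]
  push_cast
  refine Finset.sum_congr rfl fun i _ => Finset.sum_congr rfl fun j _ => ?_
  exact Complex.conj_mul' _

lemma exists_factor {n : Type*} [Fintype n] [DecidableEq n] {A : Matrix n n ℂ}
    (h : A.PosSemidef) : ∃ B : Matrix n n ℂ, A = Bᴴ * B := by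
  open scoped MatrixOrder Matrix.Norms.L2Operator in
  exact CStarAlgebra.nonneg_iff_eq_star_mul_self.mp (Matrix.nonneg_iff_posSemidef.mpr h)

lemma coeff_mul {d : ℕ} (ψ : Fin d × Fin d → ℂ) (h : IsMaxEntVec ψ) :
    coeffMat ψ * (coeffMat ψ)ᴴ = ((1 / d : ℝ) : ℂ) • (1 : Matrix (Fin d) (Fin d) ℂ) := by
  have h1 := (Matrix.isHermitian_mul_conjTranspose_self (coeffMat ψ)).spectral_theorem
  have h2 : (Matrix.isHermitian_mul_conjTranspose_self (coeffMat ψ)).eigenvalues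
    = fun _ => (1 / d : ℝ) := funext h.2
  rw [h2] at h1
  have h3 : Matrix.diagonal ((RCLike.ofReal : ℝ → ℂ) ∘ fun _ : Fin d => (1 / d : ℝ))
    = ((1 / d : ℝ) : ℂ) • (1 : Matrix (Fin d) (Fin d) ℂ) := by
    ext i j
    simp [Matrix.diagonal_apply, Matrix.one_apply]
  rw [h3, map_smul, map_one] at h1
  exact h1

lemma trace_expand {d : ℕ} (ψ : Fin d × Fin d → ℂ) (S T : Matrix (Fin d) (Fin d) ℂ) :
    ((S ⊗ₖ T) * projVec ψ).trace
      = ((coeffMat ψ)ᴴ * S * coeffMat ψ * Tᵀ).trace := by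
  rw [projVec, Matrix.mul_vecMulVec, Matrix.trace_vecMulVec]
  have : ψ = Matrix.vec (coeffMat ψ)ᵀ := by
    ext ⟨i, j⟩; simp [coeffMat, Matrix.vec]
  have h2 : (S ⊗ₖ T) *ᵥ ψ = Matrix.vec (T * (coeffMat ψ)ᵀ * Sᵀ) := by
    conv_lhs => rw [this]
    rw [Matrix.kronecker_mulVec_vec]
  rw [h2]
  have h3 : (T * (coeffMat ψ)ᵀ * Sᵀ) = (S * coeffMat ψ * Tᵀ)ᵀ := by
    simp [Matrix.transpose_mul, Matrix.mul_assoc]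
  rw [h3, show (coeffMat ψ)ᴴ * S * coeffMat ψ * Tᵀ = (coeffMat ψ)ᴴ * (S * coeffMat ψ * Tᵀ) by
    simp only [Matrix.mul_assoc]]
  generalize S * coeffMat ψ * Tᵀ = M
  rw [Matrix.trace_mul_comm]
  simp [dotProduct, Fintype.sum_prod_type, Matrix.trace, Matrix.mul_apply, Matrix.vec, coeffMat]

lemma prob_eq {d : ℕ} (ψ : Fin d × Fin d → ℂ) (h : IsMaxEntVec ψ)
    (S T : Matrix (Fin d) (Fin d) ℂ) (hS : IsState S) (hT : IsState T) :
    0 ≤ ((S ⊗ₖ T) * projVec ψ).trace.re ∧ ((S ⊗ₖ T) * projVec ψ).trace.re ≤ 1 / d := by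
  obtain ⟨B, hB⟩ := exists_factor hS.1
  obtain ⟨C, hC⟩ := exists_factor hT.1.transpose
  set A := coeffMat ψ with hA
  have e1 : ((S ⊗ₖ T) * projVec ψ).trace = (fro (B * A * Cᴴ) : ℂ) := by
    rw [trace_expand, ← trace_fro, hB, hC, ← hA]
    rw [← Matrix.mul_assoc, Matrix.trace_mul_comm]
    simp [Matrix.conjTranspose_mul, Matrix.mul_assoc]
  have e2 : fro (B * A) = 1 / d := by
    have : (fro (B * A) : ℂ) = ((1 / d : ℝ) : ℂ) := by
      rw [← trace_fro, Matrix.conjTranspose_mul, Matrix.mul_assoc, Matrix.trace_mul_comm,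
        ← Matrix.mul_assoc, Matrix.mul_assoc, hA, coeff_mul ψ h, ← hB, Matrix.mul_smul,
        Matrix.mul_one, Matrix.trace_smul, hS.2]
      simp
    exact_mod_cast this
  have e3 : fro Cᴴ = 1 := by
    have : (fro Cᴴ : ℂ) = 1 := by
      rw [← trace_fro, Matrix.conjTranspose_conjTranspose, Matrix.trace_mul_comm, ← hC,
        Matrix.trace_transpose, hT.2]
    exact_mod_cast this
  rw [e1, Complex.ofReal_re]
  refine ⟨fro_nonneg _, ?_⟩
  have := fro_mul (B * A) Cᴴ
  rwa [e2, e3, mul_one] at this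

/-- For a measurement in a maximally entangled basis and any product state σ,
H(σ, P) ≥ log₂ d. -/
theorem stmt8 {d : ℕ} (P : Fin (d^2) → Matrix (Fin d × Fin d) (Fin d × Fin d) ℂ)
    (hP : IsMaxEntMeasurement P)
    (σ : Matrix (Fin d × Fin d) (Fin d × Fin d) ℂ) (hσ : IsProductState σ) :
    Real.logb 2 d ≤ kleinEntropy σ P := by
  obtain ⟨S, T, hS, hT, rfl⟩ := hσ
  have hp : ∀ i, 0 ≤ ((S ⊗ₖ T) * P i).trace.re ∧ ((S ⊗ₖ T) * P i).trace.re ≤ 1 / d := by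
    intro i
    obtain ⟨ψ, hψ, e⟩ := hP.2 i
    rw [e]
    exact prob_eq ψ hψ S T hS hT
  have hsum : ∑ i, ((S ⊗ₖ T) * P i).trace.re = 1 := by
    rw [← Complex.re_sum, ← Matrix.trace_sum, ← Matrix.mul_sum, hP.1.2.2, Matrix.mul_one,
      Matrix.trace_kronecker, hS.2, hT.2]
    simp
  unfold kleinEntropy shannon
  calc Real.logb 2 d = ∑ i, ((S ⊗ₖ T) * P i).trace.re * Real.logb 2 d := by
        rw [← Finset.sum_mul, hsum, one_mul]
    _ ≤ _ := by
        refine Finset.sum_le_sum fun i _ => ?_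
        beta_reduce
        obtain ⟨h0, h1⟩ := hp i
        generalize ((S ⊗ₖ T) * P i).trace.re = x at h0 h1
        unfold negMulLog2
        rcases h0.eq_or_lt with h | h
        · simp [← h]
        · rw [← mul_neg]
          refine mul_le_mul_of_nonneg_left ?_ h0
          have := Real.logb_le_logb_of_le (b := 2) (by norm_num) h h1
          rw [one_div, Real.logb_inv] at this
          linarith

end EEP
end
end

section
/- Minimum Shannon entropy under a uniform bound: let (p_i)_{i ∈ Fin n} be a probability distribution (p_i ≥ 0, Σ p_i = 1) and let 0 < c ≤ 1 satisfy p_i ≤ c for all i. Then, with k = ⌊1/c⌋, the Shannon entropy satisfies −Σ_i p_i log₂ p_i ≥ −k·c·log₂ c − (1 − k·c)·log₂(1 − k·c) (with the convention 0·log₂ 0 = 0). -/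
open Matrix Kronecker BigOperators ComplexOrder

noncomputable section

namespace EEP

lemma four_pt {f : ℝ → ℝ} (hf : ConcaveOn ℝ (Set.Ici (0:ℝ)) f) {a b x y : ℝ} (ha : 0 ≤ a)
    (hx : a ≤ x) (hy : a ≤ y) (hxy : x + y = a + b) : f a + f b ≤ f x + f y := by
  have hxb : x ≤ b := by linarith
  rcases eq_or_lt_of_le (hx.trans hxb) with h | h
  · have h1 : x = a := by linarith
    have h2 : y = b := by linarith
    rw [h1, h2]
  · have hd : 0 < b - a := by linarith
    have hb : b ∈ Set.Ici (0:ℝ) := by simp only [Set.mem_Ici]; linarith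
    have ht : 0 ≤ (b - x) / (b - a) := div_nonneg (by linarith) hd.le
    have hu : 0 ≤ (x - a) / (b - a) := div_nonneg (by linarith) hd.le
    have e1 : (b - x) / (b - a) + (x - a) / (b - a) = 1 := by
      field_simp; ring
    have k1 := hf.2 (Set.mem_Ici.2 ha) hb ht hu e1
    have k2 := hf.2 (Set.mem_Ici.2 ha) hb hu ht (by linarith)
    simp only [smul_eq_mul] at k1 k2
    have i1 : (b - x) / (b - a) * a + (x - a) / (b - a) * b = x := by
      field_simp; ring
    have i2 : (x - a) / (b - a) * a + (b - x) / (b - a) * b = y := by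
      have : y = a + b - x := by linarith
      rw [this]
      field_simp; ring
    rw [i1] at k1
    rw [i2] at k2
    have : f a + f b = ((b - x) / (b - a) + (x - a) / (b - a)) * (f a + f b) := by
      rw [e1, one_mul]
    rw [this]
    linarith

lemma greedy {ι : Type*} {f : ℝ → ℝ} (hf : ConcaveOn ℝ (Set.Ici (0:ℝ)) f) (f0 : f 0 = 0)
    (p : ι → ℝ) (hp : ∀ i, 0 ≤ p i) (c : ℝ) (hc0 : 0 < c) (hpc : ∀ i, p i ≤ c) (S : Finset ι) :
    ∃ (k : ℕ) (r : ℝ), 0 ≤ r ∧ r < c ∧ ∑ i ∈ S, p i = k * c + r ∧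
      k * f c + f r ≤ ∑ i ∈ S, f (p i) := by
  classical
  induction S using Finset.induction_on with
  | empty => exact ⟨0, 0, le_rfl, hc0, by simp, by simp [f0]⟩
  | insert j S hj ih =>
    obtain ⟨k, r, hr0, hrc, hs, hle⟩ := ih
    have h0 := hp j
    have h1 := hpc j
    rw [Finset.sum_insert hj, Finset.sum_insert hj]
    by_cases h : r + p j < c
    · refine ⟨k, r + p j, by linarith, h, by linarith, ?_⟩
      have := four_pt hf (a := 0) (b := r + p j) le_rfl hr0 h0 (by ring)
      linarith
    · push Not at h
      refine ⟨k + 1, r + p j - c, by linarith, by linarith, by push_cast; linarith, ?_⟩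
      have := four_pt hf (a := r + p j - c) (b := c) (x := r) (y := p j) (by linarith)
        (by linarith) (by linarith) (by ring)
      push_cast
      linarith

lemma concave_negMulLog2 : ConcaveOn ℝ (Set.Ici (0:ℝ)) negMulLog2 := by
  have h := Real.concaveOn_negMulLog.smul (c := (Real.log 2)⁻¹)
    (inv_nonneg.2 (Real.log_nonneg (by norm_num)))
  have e : negMulLog2 = fun x => (Real.log 2)⁻¹ • Real.negMulLog x := by
    funext x
    simp only [negMulLog2, Real.negMulLog, Real.logb, smul_eq_mul]
    ring
  rw [e]
  exact h

/-- Minimum Shannon entropy under a uniform bound `pᵢ ≤ c`, with `k = ⌊1/c⌋`: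
H(p) ≥ −k c log₂ c − (1 − k c) log₂(1 − k c). -/
theorem stmt11 {n : ℕ} (p : Fin n → ℝ) (hp : ∀ i, 0 ≤ p i) (hs : (∑ i, p i) = 1)
    (c : ℝ) (hc0 : 0 < c) (hc1 : c ≤ 1) (hpc : ∀ i, p i ≤ c) :
    -((⌊1/c⌋₊ : ℝ) * c) * Real.logb 2 c
        - (1 - (⌊1/c⌋₊ : ℝ) * c) * Real.logb 2 (1 - (⌊1/c⌋₊ : ℝ) * c)
      ≤ shannon p := by
  obtain ⟨k, r, hr0, hrc, hsum, hle⟩ := greedy concave_negMulLog2 (by simp [negMulLog2])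
    p hp c hc0 hpc Finset.univ
  rw [hs] at hsum
  have hk : ⌊1/c⌋₊ = k := by
    rw [Nat.floor_eq_iff (by positivity)]
    constructor
    · rw [le_div_iff₀ hc0]; linarith
    · rw [div_lt_iff₀ hc0]; linarith
  have hr : 1 - (k:ℝ) * c = r := by linarith
  rw [hk, hr]
  unfold shannon
  refine le_trans (le_of_eq ?_) hle
  simp only [negMulLog2]
  ring

end EEP
end
end

section
/- Let P = (P_i) be a von Neumann measurement on C^d ⊗ C^d in which each P_i is the projection onto a unit vector whose largest squared Schmidt coefficient is at most c (0 < c ≤ 1). Then for every product state σ on C^d ⊗ C^d, with k = ⌊1/c⌋, the Klein entropy satisfies H(σ, P) ≥ −k·c·log₂ c − (1 − k·c)·log₂(1 − k·c). -/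
open Matrix Kronecker BigOperators ComplexOrder

noncomputable section

namespace EEP

open scoped MatrixOrder in
lemma aux_trace_mul {n : Type*} [Fintype n] [DecidableEq n] {X Y : Matrix n n ℂ}
    (hX : X.PosSemidef) (hY : Y.PosSemidef) : 0 ≤ (X * Y).trace.re := by
  obtain ⟨B, rfl⟩ := CStarAlgebra.nonneg_iff_eq_star_mul_self.mp hX.nonneg
  have h := (hY.mul_mul_conjTranspose_same B).trace_nonneg
  have e : (star B * B * Y).trace = (B * Y * Bᴴ).trace := by
    rw [Matrix.mul_assoc, Matrix.trace_mul_comm, star_eq_conjTranspose]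
  rw [e]
  exact (Complex.le_def.mp h).1

lemma aux_eig {n : Type*} [Fintype n] [DecidableEq n] {H : Matrix n n ℂ}
    (hH : H.IsHermitian) (c : ℝ) (h : ∀ i, hH.eigenvalues i ≤ c) :
    ((c : ℂ) • (1 : Matrix n n ℂ) - H).PosSemidef := by
  have hD : (Matrix.diagonal (fun i => ((c - hH.eigenvalues i : ℝ) : ℂ))).PosSemidef := by
    rw [Matrix.posSemidef_diagonal_iff]
    intro i
    have := h i
    exact_mod_cast sub_nonneg.mpr this
  have h2 := hD.mul_mul_conjTranspose_same (hH.eigenvectorUnitary : Matrix n n ℂ)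
  convert h2 using 1
  have hs := hH.spectral_theorem
  rw [Unitary.conjStarAlgAut_apply] at hs
  have hU : (hH.eigenvectorUnitary : Matrix n n ℂ) * (hH.eigenvectorUnitary : Matrix n n ℂ)ᴴ = 1 := by
    rw [← star_eq_conjTranspose]; exact Unitary.coe_mul_star_self _
  have hd : Matrix.diagonal (fun i => ((c - hH.eigenvalues i : ℝ) : ℂ))
      = (c : ℂ) • (1 : Matrix n n ℂ) - Matrix.diagonal (RCLike.ofReal ∘ hH.eigenvalues) := by
    rw [← Matrix.diagonal_one, ← Matrix.diagonal_smul, Matrix.diagonal_sub]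
    congr 1; ext i; simp
  rw [hd, Matrix.mul_sub, Matrix.sub_mul, Matrix.mul_smul, Matrix.smul_mul, Matrix.mul_one, hU]
  congr 1

lemma aux_state {n : Type*} [Fintype n] [DecidableEq n] {ρ : Matrix n n ℂ} (h : IsState ρ) :
    (1 - ρ).PosSemidef := by
  have := aux_eig h.1.isHermitian 1 (fun i => by
    have ht := h.1.isHermitian.trace_eq_sum_eigenvalues
    replace ht := h.2.symm.trans ht
    have ht' : (1 : ℝ) = ∑ i, h.1.isHermitian.eigenvalues i := by
      have := congrArg Complex.re ht
      simpa using this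
    rw [ht']
    exact Finset.single_le_sum (fun j _ => h.1.eigenvalues_nonneg j) (Finset.mem_univ i))
  simpa using this

lemma aux_prob {d : ℕ} {σA σB : Matrix (Fin d) (Fin d) ℂ} (hA : IsState σA) (hB : IsState σB)
    (ψ : Fin d × Fin d → ℂ) (c : ℝ) (hψ : maxSchmidtSq ψ ≤ c) :
    ((σA ⊗ₖ σB) * projVec ψ).trace.re ≤ c := by
  have hp : (projVec ψ).PosSemidef := Matrix.posSemidef_vecMulVec_self_star ψ
  have h1 := aux_trace_mul (hA.1.kronecker (aux_state hB)) hp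
  have h2 := aux_trace_mul hA.1 (aux_eig
    (Matrix.isHermitian_mul_conjTranspose_self (coeffMat ψ)) c
    (fun i => (le_ciSup (Set.finite_range (schmidtSq ψ)).bddAbove i).trans hψ))
  have e : ((σA ⊗ₖ (1 : Matrix (Fin d) (Fin d) ℂ)) * projVec ψ).trace
      = (σA * (coeffMat ψ * (coeffMat ψ)ᴴ)).trace := by
    simp only [Matrix.trace, Matrix.diag, Matrix.mul_apply, projVec, Matrix.vecMulVec_apply,
      coeffMat, Matrix.of_apply, Matrix.conjTranspose_apply, Fintype.sum_prod_type,
      Matrix.kroneckerMap_apply, Matrix.one_apply, Pi.star_apply, mul_ite, ite_mul, mul_one,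
      mul_zero, zero_mul, Finset.sum_ite_eq, Finset.mem_univ, if_true, Finset.mul_sum]
    exact Finset.sum_congr rfl fun i _ => Finset.sum_comm
  have e2 : (σA ⊗ₖ (1 - σB)) = σA ⊗ₖ (1 : Matrix (Fin d) (Fin d) ℂ) - σA ⊗ₖ σB := by
    ext i j
    simp [Matrix.kroneckerMap_apply, mul_sub]
  rw [e2, Matrix.sub_mul, Matrix.trace_sub, e, Complex.sub_re] at h1
  rw [Matrix.mul_sub, Matrix.trace_sub, Matrix.mul_smul, Matrix.mul_one, Matrix.trace_smul, hA.2,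
    Complex.sub_re] at h2
  simp at h2
  linarith

lemma aux_min {ι : Type*} [Fintype ι] (p : ι → ℝ) (hs : ∑ i, p i = 1) (c r : ℝ) (k : ℕ)
    (hr0 : 0 ≤ r) (hrc : r ≤ c) (hk : k * c + r = 1) (h0 : ∀ i, 0 ≤ p i) (hp : ∀ i, p i ≤ c) :
    (k + 1) * r ≤ ∑ i, min (p i) r := by
  classical
  set S := Finset.univ.filter (fun i => r ≤ p i) with hS
  by_cases hm : k + 1 ≤ S.card
  · calc ((k : ℝ) + 1) * r ≤ S.card * r := by
          gcongr; exact_mod_cast hm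
      _ = ∑ i ∈ S, min (p i) r := by
          rw [Finset.sum_congr rfl (g := fun _ => r)]
          · simp
          · intro i hi
            exact min_eq_right (Finset.mem_filter.mp hi).2
      _ ≤ _ := Finset.sum_le_sum_of_subset_of_nonneg (Finset.subset_univ _)
          (fun i _ _ => le_min (h0 i) hr0)
  · have hm' : (S.card : ℝ) ≤ k := by
      have : S.card ≤ k := by omega
      exact_mod_cast this
    have h1 : ∑ i, (p i - min (p i) r) ≤ S.card * (c - r) := by
      calc ∑ i, (p i - min (p i) r) ≤ ∑ i, (if r ≤ p i then c - r else 0) := by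
            apply Finset.sum_le_sum
            intro i _
            split_ifs with h
            · rw [min_eq_right h]; linarith [hp i]
            · rw [min_eq_left (not_le.mp h).le]; simp
        _ = _ := by rw [← Finset.sum_filter]; simp [hS]; ring
    rw [Finset.sum_sub_distrib, hs] at h1
    nlinarith [mul_le_mul_of_nonneg_right hm' (sub_nonneg.mpr hrc)]

lemma aux_ent {ι : Type*} [Fintype ι] (p : ι → ℝ) (hs : ∑ i, p i = 1) (c r : ℝ) (k : ℕ)
    (hc : 0 < c) (hr0 : 0 ≤ r) (hrc : r < c) (hk : k * c + r = 1)
    (h0 : ∀ i, 0 ≤ p i) (hp : ∀ i, p i ≤ c) :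
    k * Real.negMulLog c + Real.negMulLog r ≤ ∑ i, Real.negMulLog (p i) := by
  have lin : ∀ x y : ℝ, 0 ≤ x → x ≤ y → x * (-Real.log y) ≤ Real.negMulLog x := by
    intro x y hx hxy
    rcases hx.eq_or_lt with rfl | hx
    · simp
    · have := Real.log_le_log hx hxy
      rw [Real.negMulLog]
      nlinarith
  rcases hr0.eq_or_lt with rfl | hr
  · have : ∑ i, p i * (-Real.log c) ≤ ∑ i, Real.negMulLog (p i) :=
      Finset.sum_le_sum fun i _ => lin _ _ (h0 i) (hp i)
    rw [← Finset.sum_mul, hs, ← hk] at this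
    simp only [Real.negMulLog] at *
    linarith
  · set f := Real.negMulLog with hf
    set α := -Real.log r with hα
    set β := (f c - f r) / (c - r) with hβ
    have hcr : 0 < c - r := sub_pos.mpr hrc
    have hβ' : β * (c - r) = f c - f r := div_mul_cancel₀ _ hcr.ne'
    have hfr : f r = r * α := by simp [hf, hα, Real.negMulLog]
    have hfc : f c = c * -Real.log c := by simp [hf, Real.negMulLog]
    have hαβ : β ≤ α := by
      have := Real.log_le_log hr hrc.le
      rw [hβ, div_le_iff₀ hcr, hfr, hfc]
      nlinarith
    have key : ∀ i, β * p i + (α - β) * min (p i) r ≤ f (p i) := by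
      intro i
      rcases le_total (p i) r with h | h
      · rw [min_eq_left h]
        have := lin _ _ (h0 i) h
        linarith
      · rw [min_eq_right h]
        have hcv := Real.concaveOn_negMulLog.2 (show r ∈ Set.Ici (0 : ℝ) from hr.le)
          (show c ∈ Set.Ici (0 : ℝ) from hc.le)
          (show 0 ≤ (c - p i) / (c - r) from div_nonneg (by linarith [hp i]) hcr.le)
          (show 0 ≤ (p i - r) / (c - r) from div_nonneg (by linarith) hcr.le)
          (by field_simp; ring)
        have e : ((c - p i) / (c - r)) • r + ((p i - r) / (c - r)) • c = p i := by
          simp only [smul_eq_mul]; field_simp; ring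
        rw [e] at hcv
        refine le_trans (le_of_eq ?_) hcv
        rw [← hf]
        have : f c = β * (c - r) + f r := by linarith
        simp only [smul_eq_mul]
        rw [this, hfr]
        field_simp
        ring
    have hsum : ∑ i, (β * p i + (α - β) * min (p i) r) ≤ ∑ i, f (p i) :=
      Finset.sum_le_sum fun i _ => key i
    rw [Finset.sum_add_distrib, ← Finset.mul_sum, ← Finset.mul_sum, hs] at hsum
    have hm := mul_le_mul_of_nonneg_left (aux_min p hs c r k hr0 hrc.le hk h0 hp)
      (sub_nonneg.mpr hαβ)
    have hb : β = β * (k * c + r) := by rw [hk, mul_one]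
    have e1 : f c = β * (c - r) + r * α := by linarith
    have e2 : k * f c + f r = β + (α - β) * ((k + 1) * r) := by
      rw [e1, hfr]
      calc _ = β * (k * c + r) + (α - β) * ((k + 1) * r) := by ring
        _ = _ := by rw [hk, mul_one]
    linarith

/-- If every projector of the measurement P is onto a unit vector whose largest
squared Schmidt coefficient is at most c, then for every product state σ,
H(σ,P) ≥ −k c log₂ c − (1 − k c) log₂(1 − k c) with k = ⌊1/c⌋. -/
theorem stmt12 {d : ℕ} (c : ℝ) (hc0 : 0 < c) (hc1 : c ≤ 1)
    (P : Fin (d^2) → Matrix (Fin d × Fin d) (Fin d × Fin d) ℂ) (hP : IsMeasurement P)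
    (hvec : ∀ i, ∃ ψ, IsUnitVec ψ ∧ maxSchmidtSq ψ ≤ c ∧ P i = projVec ψ)
    (σ : Matrix (Fin d × Fin d) (Fin d × Fin d) ℂ) (hσ : IsProductState σ) :
    -((⌊1/c⌋₊ : ℝ) * c) * Real.logb 2 c
        - (1 - (⌊1/c⌋₊ : ℝ) * c) * Real.logb 2 (1 - (⌊1/c⌋₊ : ℝ) * c)
      ≤ kleinEntropy σ P := by
  obtain ⟨σA, σB, hA, hB, rfl⟩ := hσ
  set p : Fin (d^2) → ℝ := fun i => ((σA ⊗ₖ σB) * P i).trace.re with hpdef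
  have h0 : ∀ i, 0 ≤ p i := by
    intro i
    obtain ⟨ψ, -, -, h⟩ := hvec i
    simp only [hpdef, h]
    exact aux_trace_mul (hA.1.kronecker hB.1) (Matrix.posSemidef_vecMulVec_self_star ψ)
  have hp : ∀ i, p i ≤ c := by
    intro i
    obtain ⟨ψ, -, h1, h⟩ := hvec i
    simp only [hpdef, h]
    exact aux_prob hA hB ψ c h1
  have hs : ∑ i, p i = 1 := by
    simp only [hpdef]
    rw [← Complex.re_sum, ← Matrix.trace_sum, ← Finset.mul_sum, hP.2.2, Matrix.mul_one,
      Matrix.trace_kronecker, hA.2, hB.2]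
    simp
  have hk1 : (⌊1/c⌋₊ : ℝ) * c ≤ 1 := by
    have := Nat.floor_le (a := 1/c) (by positivity)
    rwa [le_div_iff₀ hc0] at this
  have hk2 : 1 < ((⌊1/c⌋₊ : ℝ) + 1) * c := by
    have := Nat.lt_floor_add_one (1/c)
    rwa [div_lt_iff₀ hc0] at this
  have main := aux_ent p hs c (1 - (⌊1/c⌋₊ : ℝ) * c) ⌊1/c⌋₊ hc0 (by linarith) (by linarith)
    (by ring) h0 hp
  have hl : 0 < Real.log 2 := Real.log_pos (by norm_num)
  have e : kleinEntropy (σA ⊗ₖ σB) P = (∑ i, Real.negMulLog (p i)) / Real.log 2 := by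
    rw [Finset.sum_div]
    simp only [kleinEntropy, shannon, negMulLog2, Real.negMulLog, Real.logb, hpdef]
    exact Finset.sum_congr rfl fun i _ => by ring
  rw [e, le_div_iff₀ hl]
  refine le_trans (le_of_eq ?_) main
  simp only [Real.negMulLog, Real.logb]
  field_simp
  ring

end EEP
end
end

section
/- For every unit vector φ ∈ C² ⊗ C² there exists an orthonormal basis (φ_1, φ_2, φ_3, φ_4) of C² ⊗ C² with φ_1 = φ such that every φ_i has the same multiset of squared Schmidt coefficients as φ (i.e. the singular values of the coefficient matrix of each φ_i coincide with those of φ). -/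
open Matrix Kronecker BigOperators ComplexOrder

noncomputable section

namespace EEP

open Matrix in
theorem exists_W (A : Matrix (Fin 2) (Fin 2) ℂ) :
    ∃ W : Matrix (Fin 2) (Fin 2) ℂ, Wᴴ * W = 1 ∧ ((Wᴴ * A) * (Wᴴ * A)ᴴ) 0 1 = 0 := by
  have h := Matrix.isHermitian_mul_conjTranspose_self A
  refine ⟨h.eigenvectorUnitary, ?_, ?_⟩
  · exact (Matrix.mem_unitaryGroup_iff'.mp h.eigenvectorUnitary.2)
  · have h2 := h.conjStarAlgAut_star_eigenvectorUnitary
    rw [Unitary.conjStarAlgAut_apply] at h2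
    have h3 := congrFun (congrFun h2 0) 1
    simp [Matrix.star_eq_conjTranspose] at h3
    simpa [Matrix.conjTranspose_mul, Matrix.mul_assoc] using h3

theorem sum_eq_trace (M N : Matrix (Fin 2) (Fin 2) ℂ) :
    (∑ p : Fin 2 × Fin 2, (starRingEnd ℂ) (M p.1 p.2) * N p.1 p.2) = (Mᴴ * N).trace := by
  simp only [Fintype.sum_prod_type, Fin.sum_univ_two, Matrix.trace_fin_two, Matrix.mul_apply,
    Matrix.conjTranspose_apply, RCLike.star_def]
  ring

theorem schmidt_eq (ψ φ : Fin 2 × Fin 2 → ℂ)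
    (h1 : (coeffMat ψ * (coeffMat ψ)ᴴ).trace = (coeffMat φ * (coeffMat φ)ᴴ).trace)
    (h2 : (coeffMat ψ * (coeffMat ψ)ᴴ).det = (coeffMat φ * (coeffMat φ)ᴴ).det) :
    schmidtSq ψ = schmidtSq φ := by
  unfold schmidtSq
  rw [Matrix.IsHermitian.eigenvalues_eq_eigenvalues_iff,
    Matrix.charpoly_fin_two, Matrix.charpoly_fin_two, h1, h2]

/-- Basis of matrices attached to a matrix with orthogonal rows. -/
def bas (D : Matrix (Fin 2) (Fin 2) ℂ) : Fin 4 → Matrix (Fin 2) (Fin 2) ℂ :=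
  ![!![D 0 0, D 0 1; D 1 0, D 1 1],
    !![D 1 0, D 1 1; D 0 0, D 0 1],
    !![star (D 1 1), -star (D 1 0); star (D 0 1), -star (D 0 0)],
    !![star (D 0 1), -star (D 0 0); star (D 1 1), -star (D 1 0)]]

/-- Every unit vector φ ∈ C² ⊗ C² extends to an orthonormal basis all of whose
members have the same squared Schmidt coefficients (up to permutation) as φ. -/
theorem stmt15 (φ : Fin 2 × Fin 2 → ℂ) (hφ : IsUnitVec φ) :
    ∃ b : Fin 4 → (Fin 2 × Fin 2 → ℂ),
      b 0 = φ ∧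
      (∀ i j, (∑ p, (starRingEnd ℂ) (b i p) * b j p) = if i = j then 1 else 0) ∧
      (∀ i, ∃ e : Equiv.Perm (Fin 2), ∀ k, schmidtSq (b i) (e k) = schmidtSq φ k) := by
  obtain ⟨W, hW, hD⟩ := exists_W (coeffMat φ)
  obtain ⟨D, hDdef⟩ : ∃ D, D = Wᴴ * coeffMat φ := ⟨_, rfl⟩
  rw [← hDdef] at hD
  have hA : coeffMat φ = W * D := by
    rw [hDdef, ← Matrix.mul_assoc, mul_eq_one_comm.mp hW, Matrix.one_mul]
  have hn : (Dᴴ * D).trace = 1 := by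
    have h1 : Dᴴ * D = (coeffMat φ)ᴴ * coeffMat φ := by
      rw [hA, Matrix.conjTranspose_mul, Matrix.mul_assoc, ← Matrix.mul_assoc Wᴴ, hW,
        Matrix.one_mul]
    rw [h1]
    have h2 : ((∑ p, Complex.normSq (φ p) : ℝ) : ℂ) = 1 := by rw [hφ]; simp
    simp only [Fintype.sum_prod_type, Fin.sum_univ_two, Complex.ofReal_add,
      Complex.normSq_eq_conj_mul_self] at h2
    simp only [Matrix.trace_fin_two, Matrix.mul_apply, Fin.sum_univ_two,
      Matrix.conjTranspose_apply, coeffMat, Matrix.of_apply, RCLike.star_def]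
    linear_combination h2
  have ho := hD
  simp only [Matrix.mul_apply, Fin.sum_univ_two, Matrix.conjTranspose_apply,
    RCLike.star_def] at ho
  have ho' := congrArg (starRingEnd ℂ) ho
  simp only [map_add, map_mul, Complex.conj_conj, map_zero] at ho'
  have hn' := hn
  simp only [Matrix.trace_fin_two, Matrix.mul_apply, Fin.sum_univ_two,
      Matrix.conjTranspose_apply, RCLike.star_def] at hn'
  have hG : ∀ i j, ((bas D i)ᴴ * bas D j).trace = if i = j then 1 else 0 := by
    intro i j
    fin_cases i <;> fin_cases j <;>
      simp [Matrix.trace_fin_two, Matrix.mul_apply, Fin.sum_univ_two, bas] <;>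
      first
      | linear_combination hn'
      | linear_combination ho + ho'
      | ring
  have hdet : ∀ i, (bas D i).det * star (bas D i).det = D.det * star D.det := by
    intro i
    fin_cases i <;> simp [Matrix.det_fin_two, bas] <;> ring
  have hc : ∀ M : Matrix (Fin 2) (Fin 2) ℂ, coeffMat (fun p => M p.1 p.2) = M := fun M => rfl
  have hb0 : (fun p : Fin 2 × Fin 2 => (W * bas D 0) p.1 p.2) = φ := by
    have : bas D 0 = D := by
      ext i j
      fin_cases i <;> fin_cases j <;> rfl
    rw [this, ← hA]
    rfl
  have hI : ∀ i j, ((W * bas D i)ᴴ * (W * bas D j)).trace = if i = j then 1 else 0 := by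
    intro i j
    rw [Matrix.conjTranspose_mul, Matrix.mul_assoc, ← Matrix.mul_assoc Wᴴ, hW,
        Matrix.one_mul, hG]
  refine ⟨fun i p => (W * bas D i) p.1 p.2, hb0, ?_, ?_⟩
  · intro i j
    rw [← hI i j]
    exact sum_eq_trace _ _
  · intro i
    refine ⟨Equiv.refl _, fun k => ?_⟩
    have key : schmidtSq (fun p : Fin 2 × Fin 2 => (W * bas D i) p.1 p.2) = schmidtSq φ := by
      apply schmidt_eq
      · rw [hc, hA, Matrix.trace_mul_comm, hI, Matrix.trace_mul_comm, Matrix.conjTranspose_mul,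
          Matrix.mul_assoc, ← Matrix.mul_assoc Wᴴ, hW, Matrix.one_mul, hn]
        simp
      · rw [hc, hA]
        simp only [Matrix.det_mul, Matrix.det_conjTranspose, star_mul]
        linear_combination (W.det * star W.det) * hdet i
    exact congrFun key k

end EEP
end
end
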